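/- For every ε > 0 one has Ñ(T,d,2ε) ≤ N(T,d,ε): if T can be covered by n open ε-balls with respect to d, then T admits an order 2ε-net of cardinality at most n. -/

import Mathlib

open scoped ENNReal NNReal
open MeasureTheory

noncomputable section

/-- A rooted tree structure on a partially ordered type with bottom element (the root):
the set of ancestors of any node is finite and totally ordered, and every node has
finitely many offspring (covering elements). -/
def IsTree (T : Type) [PartialOrder T] [OrderBot T] : Prop :=
  (∀ s : T, (Set.Iic s).Finite) ∧
  (∀ s a b : T, a ≤ s → b ≤ s → a ≤ b ∨ b ≤ a) ∧
  (∀ t : T, {s : T | t ⋖ s}.Finite)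

/-- The binary tree: a rooted tree in which every node has exactly two offspring. -/
def IsBinaryTree (T : Type) [PartialOrder T] [OrderBot T] : Prop :=
  IsTree T ∧ ∀ t : T, Nat.card {s : T | t ⋖ s} = 2

/-- `glb` assigns to any two nodes their greatest common ancestor. -/
def IsGCA {T : Type} [PartialOrder T] (glb : T → T → T) : Prop :=
  ∀ t s : T, glb t s ≤ t ∧ glb t s ≤ s ∧ ∀ u : T, u ≤ t → u ≤ s → u ≤ glb t s

/-- The generation `|t|` of a node: the number of its strict ancestors. -/
def gen {T : Type} [PartialOrder T] (t : T) : ℕ := Nat.card (Set.Iio t)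

/-- The distance `max_{t ≺ v ⪯ s} (∑_{t ≺ r ⪯ v} α(r)^q)^{1/q} σ(v)` along a branch. -/
def dOrd {T : Type} [PartialOrder T] (q : ℝ) (α σ : T → ℝ) (t s : T) : ℝ :=
  sSup ((fun v => (∑ᶠ r ∈ Set.Ioc t v, α r ^ q) ^ (1 / q) * σ v) '' Set.Ioc t s)

/- The tree metric `d`, extended by symmetry and via greatest common ancestors. -/
open Classical in
def treeDist {T : Type} [PartialOrder T] (q : ℝ) (α σ : T → ℝ)
    (glb : T → T → T) (t s : T) : ℝ :=
  if t ≤ s then dOrd q α σ t s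
  else if s ≤ t then dOrd q α σ s t
  else dOrd q α σ (glb t s) t + dOrd q α σ (glb t s) s

/-- `N(T,d,ε)`: minimal number of open `ε`-balls needed to cover `T` (`∞` if none). -/
def coveringNumber {T : Type} (d : T → T → ℝ) (ε : ℝ) : ℝ≥0∞ :=
  ⨅ S ∈ {S : Finset T | ∀ t : T, ∃ s ∈ S, d s t < ε}, (S.card : ℝ≥0∞)

/-- `Ñ(T,d,ε)`: minimal cardinality of an order `ε`-net of `T`. -/
def orderCoveringNumber {T : Type} [PartialOrder T] (d : T → T → ℝ) (ε : ℝ) : ℝ≥0∞ :=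
  ⨅ S ∈ {S : Finset T | ∀ t : T, ∃ s ∈ S, s ≤ t ∧ d s t < ε}, (S.card : ℝ≥0∞)

/-- Minimal number of open `ε`-balls of a normed space needed to cover the set `A`. -/
def setCoveringNumber {Y : Type} [NormedAddCommGroup Y] (A : Set Y) (ε : ℝ) : ℝ≥0∞ :=
  ⨅ F ∈ {F : Finset Y | ∀ a ∈ A, ∃ y ∈ F, ‖a - y‖ < ε}, (F.card : ℝ≥0∞)

/-- The dyadic entropy numbers `e_n(V)` of an operator `V`. -/
def entropyNumber {X Y : Type} [NormedAddCommGroup X] [NormedSpace ℝ X]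
    [NormedAddCommGroup Y] [NormedSpace ℝ Y] (n : ℕ) (V : X →L[ℝ] Y) : ℝ :=
  sInf {ε : ℝ | 0 < ε ∧ ∃ F : Finset Y, F.card ≤ 2 ^ (n - 1) ∧
    ∀ x : X, ‖x‖ ≤ 1 → ∃ y ∈ F, ‖V x - y‖ < ε}

/-- The space `ℓ₁(T)`. -/
abbrev ellOne (T : Type) := lp (fun _ : T => ℝ) 1

/-- The space `ℓ_q(T)`. -/
abbrev ellQ (T : Type) (q : ℝ) := lp (fun _ : T => ℝ) (ENNReal.ofReal q)

section Branch

variable {T : Type} [PartialOrder T]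

lemma dOrd_nonneg {q : ℝ} {α σ : T → ℝ} (hα : ∀ t, 0 < α t) (hσ : ∀ t, 0 < σ t) (t s : T) :
    0 ≤ dOrd q α σ t s := by
  refine Real.sSup_nonneg ?_
  rintro _ ⟨v, -, rfl⟩
  exact mul_nonneg (Real.rpow_nonneg (finsum_nonneg fun r => finsum_nonneg fun _ =>
    (Real.rpow_pos_of_pos (hα r) q).le) _) (hσ v).le

lemma dOrd_self (q : ℝ) (α σ : T → ℝ) (t : T) : dOrd q α σ t t = 0 := by
  simp [dOrd]

lemma le_dOrd (hfin : ∀ s : T, (Set.Iic s).Finite) (q : ℝ) (α σ : T → ℝ) {t v s : T}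
    (hv : v ∈ Set.Ioc t s) :
    (∑ᶠ r ∈ Set.Ioc t v, α r ^ q) ^ (1 / q) * σ v ≤ dOrd q α σ t s :=
  le_csSup (((hfin s).subset fun _ h => h.2).image _).bddAbove ⟨v, hv, rfl⟩

lemma dOrd_mono_right (hfin : ∀ s : T, (Set.Iic s).Finite) {q : ℝ} {α σ : T → ℝ}
    (hα : ∀ t, 0 < α t) (hσ : ∀ t, 0 < σ t) {t u s : T} (hus : u ≤ s) :
    dOrd q α σ t u ≤ dOrd q α σ t s := by
  refine Real.sSup_le ?_ (dOrd_nonneg hα hσ t s)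
  rintro _ ⟨v, hv, rfl⟩
  exact le_dOrd hfin q α σ ⟨hv.1, hv.2.trans hus⟩

/-- The triangle inequality for `dOrd` along a branch `a ≤ b ≤ c`. -/
lemma dOrd_triangle (hfin : ∀ s : T, (Set.Iic s).Finite)
    (hchain : ∀ s a b : T, a ≤ s → b ≤ s → a ≤ b ∨ b ≤ a) {q : ℝ} (hq : 1 ≤ q)
    {α σ : T → ℝ} (hα : ∀ t, 0 < α t) (hσ : ∀ t, 0 < σ t)
    (hσmono : ∀ ⦃t s : T⦄, t ≤ s → σ s ≤ σ t) {a b c : T} (hab : a ≤ b) (hbc : b ≤ c) :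
    dOrd q α σ a c ≤ dOrd q α σ a b + dOrd q α σ b c := by
  have hnn := dOrd_nonneg (q := q) hα hσ
  rcases hab.eq_or_lt with rfl | hab'
  · linarith [hnn a a]
  refine Real.sSup_le ?_ (add_nonneg (hnn _ _) (hnn _ _))
  rintro _ ⟨v, hv, rfl⟩
  have hsum : ∀ x y : T, 0 ≤ ∑ᶠ r ∈ Set.Ioc x y, α r ^ q := fun x y =>
    finsum_nonneg fun r => finsum_nonneg fun _ => (Real.rpow_pos_of_pos (hα r) q).le
  by_cases hvb : v ≤ b
  · exact (le_dOrd hfin q α σ ⟨hv.1, hvb⟩).trans (le_add_of_nonneg_right (hnn b c))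
  have hbv : b ≤ v := (hchain c v b hv.2 hbc).resolve_left hvb
  have hbv' : b < v := lt_of_le_not_ge hbv hvb
  have hsplit : Set.Ioc a v = Set.Ioc a b ∪ Set.Ioc b v := by
    ext r
    constructor
    · rintro ⟨har, hrv⟩
      by_cases hrb : r ≤ b
      · exact Or.inl ⟨har, hrb⟩
      · exact Or.inr ⟨lt_of_le_not_ge ((hchain v r b hrv hbv).resolve_left hrb) hrb, hrv⟩
    · rintro (⟨har, hrb⟩ | ⟨hbr, hrv⟩)
      · exact ⟨har, hrb.trans hbv⟩
      · exact ⟨hab'.trans hbr, hrv⟩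
  have hdisj : Disjoint (Set.Ioc a b) (Set.Ioc b v) :=
    Set.disjoint_left.2 fun r hr hr' => not_le_of_gt hr'.1 hr.2
  have hfinIoc : ∀ x y : T, (Set.Ioc x y).Finite := fun x y => (hfin y).subset fun _ h => h.2
  have hpow := Real.rpow_add_le_add_rpow (p := 1 / q) (hsum a b) (hsum b v) (by positivity)
    ((div_le_one (by positivity)).2 hq)
  calc (∑ᶠ r ∈ Set.Ioc a v, α r ^ q) ^ (1 / q) * σ v
      ≤ ((∑ᶠ r ∈ Set.Ioc a b, α r ^ q) ^ (1 / q)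
          + (∑ᶠ r ∈ Set.Ioc b v, α r ^ q) ^ (1 / q)) * σ v := by
        rw [hsplit, finsum_mem_union hdisj (hfinIoc _ _) (hfinIoc _ _)]
        exact mul_le_mul_of_nonneg_right hpow (hσ v).le
    _ ≤ (∑ᶠ r ∈ Set.Ioc a b, α r ^ q) ^ (1 / q) * σ b
          + (∑ᶠ r ∈ Set.Ioc b v, α r ^ q) ^ (1 / q) * σ v := by
        rw [add_mul]
        gcongr
        · exact Real.rpow_nonneg (hsum _ _) _
        · exact hσmono hbv
    _ ≤ dOrd q α σ a b + dOrd q α σ b c :=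
        add_le_add (le_dOrd hfin q α σ ⟨hab', le_rfl⟩) (le_dOrd hfin q α σ ⟨hbv', hv.2⟩)

/-- Among the ancestors of `s` at distance less than `ε` from `s` there is a least one. -/
lemma exists_least_ancestor (hfin : ∀ s : T, (Set.Iic s).Finite)
    (hchain : ∀ s a b : T, a ≤ s → b ≤ s → a ≤ b ∨ b ≤ a) (q : ℝ) (α σ : T → ℝ)
    {ε : ℝ} (hε : 0 < ε) (s : T) : ∃ m, IsLeast {u | u ≤ s ∧ dOrd q α σ u s < ε} m := by
  obtain ⟨m, hm⟩ := ((hfin s).subset fun u (hu : u ≤ s ∧ dOrd q α σ u s < ε) => hu.1).exists_minimal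
    ⟨s, le_rfl, by rwa [dOrd_self]⟩
  exact ⟨m, hm.1, fun u hu => (hchain s m u hm.1.1 hu.1).elim id (hm.2 hu)⟩

end Branch

theorem stmt1 {T : Type} [Countable T] [PartialOrder T] [OrderBot T]
    (htree : IsTree T) (q : ℝ) (hq : 1 < q)
    (α σ : T → ℝ) (hα : ∀ t, 0 < α t) (hσpos : ∀ t, 0 < σ t)
    (hσmono : ∀ ⦃t s : T⦄, t ≤ s → σ s ≤ σ t)
    (K : ℝ) (hK : ∀ s : T, (∑ᶠ r ∈ Set.Iic s, α r ^ q) ^ (1 / q) * σ s ≤ K)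
    (glb : T → T → T) (hglb : IsGCA glb) :
    ∀ ε : ℝ, 0 < ε →
      orderCoveringNumber (treeDist q α σ glb) (2 * ε) ≤
        coveringNumber (treeDist q α σ glb) ε := by
  classical
  obtain ⟨hfin, hchain, -⟩ := htree
  intro ε hε
  have hnn := dOrd_nonneg (q := q) hα hσpos
  choose m hm using exists_least_ancestor hfin hchain q α σ hε
  refine le_iInf₂ fun S hS => ?_
  refine iInf₂_le_of_le (S.image m) (fun t => ?_) (by exact_mod_cast Finset.card_image_le)
  obtain ⟨s, hs, hst⟩ := hS t
  obtain ⟨⟨hms, hmd⟩, hleast⟩ := hm s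
  refine ⟨m s, Finset.mem_image_of_mem m hs, ?_⟩
  suffices h : ∃ w, w ≤ s ∧ w ≤ t ∧ dOrd q α σ w s < ε ∧ dOrd q α σ w t < ε by
    obtain ⟨w, hws, hwt, hds, hdt⟩ := h
    have hmw : m s ≤ w := hleast ⟨hws, hds⟩
    refine ⟨hmw.trans hwt, ?_⟩
    rw [treeDist, if_pos (hmw.trans hwt)]
    linarith [dOrd_triangle hfin hchain hq.le hα hσpos hσmono hmw hwt,
      dOrd_mono_right (q := q) (t := m s) hfin hα hσpos hws]
  unfold treeDist at hst
  split_ifs at hst with h₁ h₂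
  · exact ⟨s, le_rfl, h₁, by rwa [dOrd_self], hst⟩
  · exact ⟨t, h₂, le_rfl, hst, by rwa [dOrd_self]⟩
  · obtain ⟨hgs, hgt, -⟩ := hglb s t
    exact ⟨glb s t, hgs, hgt, by linarith [hnn (glb s t) t], by linarith [hnn (glb s t) s]⟩
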